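/- The function P satisfies: (i) for all s, t ∈ ℝ, min{α_min^s, α_max^s}·P(t,0) ≤ P(s+t,0) ≤ max{α_min^s, α_max^s}·P(t,0), and for all s ∈ ℝ and q ≥ 0, P(s,q) ≤ p_max^q · P(s,0); (ii) P is continuous on ℝ×(0,∞) and on ℝ×{0}; (iii) for each fixed q ≥ 0 the map s ↦ P(s,q) is strictly decreasing, and for each fixed s the map q ↦ P(s,q) is strictly decreasing on [0,∞); (iv) for each q ≥ 0 there is a unique s ∈ ℝ with P(s,q) = 1. -/

import Mathlib

open MeasureTheory Filter Set

attribute [local instance] Classical.propDecidable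

noncomputable section

/-- Data of a box-like planar self-affine IFS: each map is `S i = T i ∘ L i + t i`, where
`T i` is the diagonal contraction `diag (c i, d i)` with `c i, d i ∈ (0,1)` and `L i` is a
linear isometry of the plane preserving `[-1,1]²`, i.e. one of the eight symmetries of the
square, encoded by whether it swaps the two axes (`swap`) and by a sign on each coordinate. -/
structure IFSData (ι : Type) where
  c : ι → ℝ
  d : ι → ℝ
  swap : ι → Bool
  sgn1 : ι → Bool
  sgn2 : ι → Bool
  t : ι → ℝ × ℝ

namespace IFSData

variable {ι : Type}

/-- The affine contraction `S i = T i ∘ L i + t i`. -/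
def S (B : IFSData ι) (i : ι) (x : ℝ × ℝ) : ℝ × ℝ :=
  ((if B.sgn1 i then 1 else -1) * (B.c i * (if B.swap i then x.2 else x.1)) + (B.t i).1,
   (if B.sgn2 i then 1 else -1) * (B.d i * (if B.swap i then x.1 else x.2)) + (B.t i).2)

/-- `(b(i), h(i))`: base and height of the rectangle `S_i([0,1]²)` for a finite word `i`. -/
def dims (B : IFSData ι) (l : List ι) : ℝ × ℝ :=
  l.foldr (fun i w =>
    (B.c i * (if B.swap i then w.2 else w.1), B.d i * (if B.swap i then w.1 else w.2))) (1, 1)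

/-- `α₁(i)`: the larger singular value of the linear part of `S_i`. -/
def alpha1 (B : IFSData ι) (l : List ι) : ℝ := max (B.dims l).1 (B.dims l).2

/-- `α₂(i)`: the smaller singular value of the linear part of `S_i`. -/
def alpha2 (B : IFSData ι) (l : List ι) : ℝ := min (B.dims l).1 (B.dims l).2

/-- Whether the composite map of the word maps horizontal lines to vertical lines. -/
def swapW (B : IFSData ι) (l : List ι) : Bool := l.foldr (fun i b => xor (B.swap i) b) false

/-- The composite map `S_{i₁} ∘ ⋯ ∘ S_{i_k}` of a word. -/
def Sw (B : IFSData ι) (l : List ι) : ℝ × ℝ → ℝ × ℝ := l.foldr (fun i f => B.S i ∘ f) id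

/-- The word `i` projects onto the first coordinate, i.e. `π_i = π₁`. -/
def usesPi1 (B : IFSData ι) (l : List ι) : Prop :=
  (B.swapW l = false ∧ (B.dims l).2 ≤ (B.dims l).1) ∨
    (B.swapW l = true ∧ (B.dims l).1 < (B.dims l).2)

/-- The projection `π_i` onto the direction of the longest side of `S_i([0,1]²)`. -/
def projW (B : IFSData ι) (l : List ι) : ℝ × ℝ → ℝ :=
  if B.usesPi1 l then Prod.fst else Prod.snd

/-- The rectangular open set condition. -/
def ROSC (B : IFSData ι) : Prop :=
  ∃ x₁ x₂ y₁ y₂ : ℝ, x₁ < x₂ ∧ y₁ < y₂ ∧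
    (∀ i, B.S i '' (Set.Ioo x₁ x₂ ×ˢ Set.Ioo y₁ y₂) ⊆ Set.Ioo x₁ x₂ ×ˢ Set.Ioo y₁ y₂) ∧
    Pairwise fun i j =>
      Disjoint (B.S i '' (Set.Ioo x₁ x₂ ×ˢ Set.Ioo y₁ y₂))
        (B.S j '' (Set.Ioo x₁ x₂ ×ˢ Set.Ioo y₁ y₂))

end IFSData

/-- `p(i)`: the probability of a finite word. -/
def wordProb {ι : Type} (p : ι → ℝ) (l : List ι) : ℝ := (l.map p).prod

/-- `τ_i(q)`: the value of the `L^q`-spectrum of the projection `π_i μ`. -/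
def tauW {ι : Type} (B : IFSData ι) (τ1 τ2 : ℝ → ℝ) (l : List ι) (q : ℝ) : ℝ :=
  if B.usesPi1 l then τ1 q else τ2 q

/-- The `q`-modified singular value function `ψ^{s,q}`. -/
def psiSV {ι : Type} (B : IFSData ι) (p : ι → ℝ) (τ1 τ2 : ℝ → ℝ) (s q : ℝ) (l : List ι) : ℝ :=
  wordProb p l ^ q * B.alpha1 l ^ tauW B τ1 τ2 l q * B.alpha2 l ^ (s - tauW B τ1 τ2 l q)

/-- `Ψ_k^{s,q} = ∑_{i ∈ I^k} ψ^{s,q}(i)`. -/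
def PsiSV {ι : Type} [Fintype ι] (B : IFSData ι) (p : ι → ℝ) (τ1 τ2 : ℝ → ℝ)
    (k : ℕ) (s q : ℝ) : ℝ :=
  ∑ f : Fin k → ι, psiSV B p τ1 τ2 s q (List.ofFn f)

/-- The lower `L^q`-spectrum of a measure. -/
def lowerLq {X : Type*} [MeasurableSpace X] [PseudoMetricSpace X] (ν : Measure X) (q : ℝ) : ℝ :=
  liminf (fun δ : ℝ =>
      Real.log (∫ x, (ν (Metric.ball x δ)).toReal ^ (q - 1) ∂ν) / (-Real.log δ))
    (nhdsWithin 0 (Set.Ioi 0))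

/-- The upper `L^q`-spectrum of a measure. -/
def upperLq {X : Type*} [MeasurableSpace X] [PseudoMetricSpace X] (ν : Measure X) (q : ℝ) : ℝ :=
  limsup (fun δ : ℝ =>
      Real.log (∫ x, (ν (Metric.ball x δ)).toReal ^ (q - 1) ∂ν) / (-Real.log δ))
    (nhdsWithin 0 (Set.Ioi 0))

/-- The `L^q`-spectrum of `ν` exists and equals `t`. -/
def IsLqSpec {X : Type*} [MeasurableSpace X] [PseudoMetricSpace X]
    (ν : Measure X) (q t : ℝ) : Prop :=
  lowerLq ν q = t ∧ upperLq ν q = t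

/-- `α_min = min_{i ∈ I} α₂(i)`. -/
def alphaMin {ι : Type} [Fintype ι] [Nonempty ι] (B : IFSData ι) : ℝ :=
  Finset.univ.inf' Finset.univ_nonempty fun i => min (B.c i) (B.d i)

/-- `α_max = max_{i ∈ I} α₁(i)`. -/
def alphaMax {ι : Type} [Fintype ι] [Nonempty ι] (B : IFSData ι) : ℝ :=
  Finset.univ.sup' Finset.univ_nonempty fun i => max (B.c i) (B.d i)

/-- `p_max = max_{i ∈ I} p_i`. -/
def pMax {ι : Type} [Fintype ι] [Nonempty ι] (p : ι → ℝ) : ℝ :=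
  Finset.univ.sup' Finset.univ_nonempty p

/-- The `δ`-stopping `I_δ`. -/
def stopping {ι : Type} (B : IFSData ι) (δ : ℝ) : Set (List ι) :=
  {l | l ≠ [] ∧ B.alpha2 l < δ ∧ δ ≤ B.alpha2 l.dropLast}

/-! ### Part A: regularity of the `L^q`-spectrum -/

lemma aux_cover (ν : Measure ℝ) [IsProbabilityMeasure ν] (K : Set ℝ) (hK : IsCompact K)
    (hν : ν Kᶜ = 0) :
    ∃ C : ℝ, 0 < C ∧ ∀ δ : ℝ, 0 < δ → δ < 1 →
      ∫⁻ x, (ν (Metric.ball x δ))⁻¹ ∂ν ≤ ENNReal.ofReal (C / δ) := by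
  obtain ⟨R, hR0, hR⟩ : ∃ R : ℝ, 0 ≤ R ∧ K ⊆ Set.Icc (-R) R := by
    obtain ⟨r, hr⟩ := hK.isBounded.subset_closedBall (0 : ℝ)
    refine ⟨max r 0, le_max_right _ _, fun x hx => ?_⟩
    have := hr hx
    rw [Metric.mem_closedBall, Real.dist_eq, sub_zero, abs_le] at this
    have h2 := le_max_left r 0
    exact ⟨by linarith, by linarith⟩
  refine ⟨2 * R + 1, by linarith, fun δ hδ hδ1 => ?_⟩
  set N : ℕ := ⌊2 * R / δ⌋₊ + 1 with hN
  let J : Fin N → Set ℝ := fun j => Set.Ico (-R + (j : ℕ) * δ) (-R + ((j : ℕ) + 1) * δ)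
  have hcov : K ⊆ ⋃ j, J j := by
    intro x hx
    obtain ⟨h1, h2⟩ := hR hx
    have hnn : 0 ≤ (x + R) / δ := div_nonneg (by linarith) hδ.le
    have hle : (x + R) / δ ≤ 2 * R / δ := by
      apply div_le_div_of_nonneg_right _ hδ.le; linarith
    have hlt : ⌊(x + R) / δ⌋₊ < N := Nat.lt_succ_of_le (Nat.floor_mono hle)
    refine Set.mem_iUnion.2 ⟨⟨_, hlt⟩, ?_, ?_⟩
    · have := Nat.floor_le hnn
      rw [le_div_iff₀ hδ] at this
      simp only; linarith
    · have := Nat.lt_floor_add_one ((x + R) / δ)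
      rw [div_lt_iff₀ hδ] at this
      simp only; linarith
  have hfull : ∀ᵐ x ∂ν, x ∈ (⋃ j, J j) := by
    rw [ae_iff]
    refine measure_mono_null ?_ hν
    intro x hx hxK
    exact hx (hcov hxK)
  have hstep : ∀ j, ∫⁻ x in J j, (ν (Metric.ball x δ))⁻¹ ∂ν ≤ 1 := by
    intro j
    calc ∫⁻ x in J j, (ν (Metric.ball x δ))⁻¹ ∂ν ≤ ∫⁻ x in J j, (ν (J j))⁻¹ ∂ν := by
          refine setLIntegral_mono' measurableSet_Ico ?_
          intro x hx
          apply ENNReal.inv_le_inv.2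
          apply measure_mono
          intro y hy
          rw [Metric.mem_ball, Real.dist_eq, abs_lt]
          simp only [J, Set.mem_Ico] at hx hy
          constructor <;> nlinarith [hx.1, hx.2, hy.1, hy.2]
      _ = (ν (J j))⁻¹ * ν (J j) := by simp
      _ ≤ 1 := ENNReal.inv_mul_le_one _
  calc ∫⁻ x, (ν (Metric.ball x δ))⁻¹ ∂ν = ∫⁻ x in ⋃ j, J j, (ν (Metric.ball x δ))⁻¹ ∂ν := by
        rw [Measure.restrict_eq_self_of_ae_mem hfull]
    _ ≤ ∑' j, ∫⁻ x in J j, (ν (Metric.ball x δ))⁻¹ ∂ν := lintegral_iUnion_le _ _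
    _ = ∑ j, ∫⁻ x in J j, (ν (Metric.ball x δ))⁻¹ ∂ν := tsum_fintype _
    _ ≤ ∑ _j : Fin N, 1 := Finset.sum_le_sum fun j _ => hstep j
    _ = ENNReal.ofReal (N : ℝ) := by simp
    _ ≤ ENNReal.ofReal ((2 * R + 1) / δ) := by
        apply ENNReal.ofReal_le_ofReal
        have h1 : (⌊2 * R / δ⌋₊ : ℝ) ≤ 2 * R / δ := Nat.floor_le (by positivity)
        have h2 : 1 ≤ 1 / δ := by rw [le_div_iff₀ hδ]; linarith
        rw [hN, add_div]; push_cast; linarith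

lemma aux_meas (ν : Measure ℝ) [IsProbabilityMeasure ν] (δ : ℝ) :
    Measurable fun x => ν (Metric.ball x δ) := by
  have hs : MeasurableSet {z : ℝ × ℝ | dist z.2 z.1 < δ} := by
    apply measurableSet_lt <;> fun_prop
  exact measurable_measure_prodMk_left (ν := ν) hs

/-- properties of `q ↦ ∫ m^(q-1)` -/
lemma aux_G {Ω : Type*} [MeasurableSpace Ω] (ν : Measure Ω) [IsProbabilityMeasure ν]
    (m : Ω → ℝ) (hm : Measurable m) (h0 : ∀ᵐ x ∂ν, 0 < m x) (h1 : ∀ x, m x ≤ 1)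
    (N : ℝ) (hint : Integrable (fun x => (m x)⁻¹) ν) (hN : ∫ x, (m x)⁻¹ ∂ν ≤ N) :
    AntitoneOn (fun q : ℝ => Real.log (∫ x, m x ^ (q - 1) ∂ν)) (Set.Ici 0) ∧
    ConvexOn ℝ (Set.Ici 0) (fun q : ℝ => Real.log (∫ x, m x ^ (q - 1) ∂ν)) ∧
    ∀ q : ℝ, 0 ≤ q → |Real.log (∫ x, m x ^ (q - 1) ∂ν)| ≤ (q + 1) * Real.log N := by
  have hI : ∀ q : ℝ, 0 ≤ q → Integrable (fun x => m x ^ (q - 1)) ν := by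
    intro q hq
    refine hint.mono' (hm.pow_const _).aestronglyMeasurable ?_
    filter_upwards [h0] with x hx
    rw [Real.norm_of_nonneg (Real.rpow_nonneg hx.le _), ← Real.rpow_neg_one]
    exact Real.rpow_le_rpow_of_exponent_ge hx (h1 x) (by linarith)
  have hpos : ∀ q : ℝ, 0 ≤ q → 0 < ∫ x, m x ^ (q - 1) ∂ν := by
    intro q hq
    rw [integral_pos_iff_support_of_nonneg_ae _ (hI q hq)]
    · have : ∀ᵐ x ∂ν, x ∈ Function.support fun x => m x ^ (q - 1) := by
        filter_upwards [h0] with x hx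
        exact (Real.rpow_pos_of_pos hx _).ne'
      have h2 : ν (Function.support fun x => m x ^ (q - 1)) = ν Set.univ :=
        measure_congr (eventuallyEq_univ.2 this)
      rw [h2, measure_univ]
      exact one_pos
    · filter_upwards [h0] with x hx
      exact (Real.rpow_pos_of_pos hx _).le
  have hanti : AntitoneOn (fun q : ℝ => Real.log (∫ x, m x ^ (q - 1) ∂ν)) (Set.Ici 0) := by
    intro q hq q' hq' hqq
    apply Real.log_le_log (hpos q' hq')
    apply integral_mono_ae (hI q' hq') (hI q hq)
    filter_upwards [h0] with x hx
    exact Real.rpow_le_rpow_of_exponent_ge hx (h1 x) (by linarith)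
  have hconv : ConvexOn ℝ (Set.Ici 0) (fun q : ℝ => Real.log (∫ x, m x ^ (q - 1) ∂ν)) := by
    refine ⟨convex_Ici 0, ?_⟩
    intro x hx y hy a b ha hb hab
    have hx' : 0 ≤ x := hx
    have hy' : 0 ≤ y := hy
    simp only [smul_eq_mul]
    have hz : 0 ≤ a * x + b * y := by positivity
    set U := ∫ w, m w ^ (x - 1) ∂ν with hU
    set V := ∫ w, m w ^ (y - 1) ∂ν with hV
    have hUp : 0 < U := hpos x hx'
    have hVp : 0 < V := hpos y hy'
    have key : ∫ w, m w ^ (a * x + b * y - 1) ∂ν ≤ U ^ a * V ^ b := by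
      have e : ∫ w, (U ^ a * V ^ b) * (a * (m w ^ (x - 1) / U) + b * (m w ^ (y - 1) / V)) ∂ν
          = U ^ a * V ^ b := by
        rw [integral_const_mul, integral_add, integral_const_mul, integral_const_mul,
          integral_div, integral_div, ← hU, ← hV, div_self hUp.ne', div_self hVp.ne']
        · rw [mul_one, mul_one, hab, mul_one]
        · exact ((hI x hx').div_const U).const_mul a
        · exact ((hI y hy').div_const V).const_mul b
      rw [← e]
      apply integral_mono_ae (hI _ hz)
      · exact ((((hI x hx').div_const U).const_mul a).add
          (((hI y hy').div_const V).const_mul b)).const_mul _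
      · filter_upwards [h0] with w hw
        have hu := Real.rpow_pos_of_pos hw (x - 1)
        have hv := Real.rpow_pos_of_pos hw (y - 1)
        have := Real.geom_mean_le_arith_mean2_weighted ha hb (div_pos hu hUp).le
          (div_pos hv hVp).le hab
        have h3 : m w ^ (a * x + b * y - 1) =
            (U ^ a * V ^ b) * ((m w ^ (x - 1) / U) ^ a * (m w ^ (y - 1) / V) ^ b) := by
          rw [Real.div_rpow hu.le hUp.le, Real.div_rpow hv.le hVp.le, ← Real.rpow_mul hw.le,
            ← Real.rpow_mul hw.le]
          have hUa := (Real.rpow_pos_of_pos hUp a).ne'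
          have hVb := (Real.rpow_pos_of_pos hVp b).ne'
          field_simp
          rw [← Real.rpow_add hw]
          congr 1
          linear_combination (1 : ℝ) * hab
        rw [h3]
        exact mul_le_mul_of_nonneg_left this (by positivity)
    calc Real.log (∫ w, m w ^ (a * x + b * y - 1) ∂ν) ≤ Real.log (U ^ a * V ^ b) :=
          Real.log_le_log (hpos _ hz) key
      _ = a * Real.log U + b * Real.log V := by
          rw [Real.log_mul (Real.rpow_pos_of_pos hUp a).ne' (Real.rpow_pos_of_pos hVp b).ne',
            Real.log_rpow hUp, Real.log_rpow hVp]
  refine ⟨hanti, hconv, ?_⟩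
  intro q hq
  have hG1 : Real.log (∫ x, m x ^ ((1 : ℝ) - 1) ∂ν) = 0 := by simp
  have hG0 : Real.log (∫ x, m x ^ ((0 : ℝ) - 1) ∂ν) ≤ Real.log N := by
    apply Real.log_le_log (hpos 0 le_rfl)
    refine le_trans (le_of_eq ?_) hN
    congr 1; ext x; rw [zero_sub, Real.rpow_neg_one]
  have hm01 := hanti (show (0 : ℝ) ∈ Set.Ici 0 from le_refl (0 : ℝ))
    (show (1 : ℝ) ∈ Set.Ici 0 from zero_le_one' ℝ) zero_le_one
  have hm0q := hanti (show (0 : ℝ) ∈ Set.Ici 0 from le_refl (0 : ℝ)) (show q ∈ Set.Ici 0 from hq) hq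
  simp only at hm01 hm0q
  rw [hG1] at hm01
  have hN0 : 0 ≤ Real.log N := hm01.trans hG0
  rw [abs_le]
  constructor
  · rcases le_total q 1 with h | h
    · have := hanti (show q ∈ Set.Ici 0 from hq) (show (1 : ℝ) ∈ Set.Ici 0 from zero_le_one' ℝ) h
      simp only at this
      rw [hG1] at this
      nlinarith
    · have hq0 : 0 < q := by linarith
      have := hconv.2 (show (0 : ℝ) ∈ Set.Ici 0 from le_refl (0 : ℝ)) (show q ∈ Set.Ici 0 from hq)
        (show 0 ≤ 1 - 1 / q by rw [sub_nonneg, div_le_one hq0]; exact h)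
        (show 0 ≤ 1 / q by positivity) (by ring)
      simp only [smul_eq_mul, mul_zero, zero_add] at this
      rw [one_div_mul_cancel hq0.ne', hG1] at this
      have h2 := mul_le_mul_of_nonneg_left this hq
      have h3 : q * ((1 - 1 / q) * Real.log (∫ x, m x ^ ((0 : ℝ) - 1) ∂ν) +
          1 / q * Real.log (∫ x, m x ^ (q - 1) ∂ν)) =
          (q - 1) * Real.log (∫ x, m x ^ ((0 : ℝ) - 1) ∂ν) +
            Real.log (∫ x, m x ^ (q - 1) ∂ν) := by
        field_simp
      rw [h3] at h2
      nlinarith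
  · nlinarith

lemma aux_spec (ν : Measure ℝ) [IsProbabilityMeasure ν] (K : Set ℝ) (hK : IsCompact K)
    (hν : ν Kᶜ = 0) (τ : ℝ → ℝ) (hτ : ∀ q : ℝ, 0 ≤ q → IsLqSpec ν q (τ q)) :
    AntitoneOn τ (Set.Ici 0) ∧ ContinuousOn τ (Set.Ioi 0) := by
  obtain ⟨C, hC, hcov⟩ := aux_cover ν K hK hν
  set F : ℝ → ℝ → ℝ := fun q δ =>
    Real.log (∫ x, (ν (Metric.ball x δ)).toReal ^ (q - 1) ∂ν) / (-Real.log δ) with hF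
  have hG : ∀ δ : ℝ, 0 < δ → δ < 1 →
      AntitoneOn (fun q => F q δ) (Set.Ici 0) ∧ ConvexOn ℝ (Set.Ici 0) (fun q => F q δ) ∧
      ∀ q : ℝ, 0 ≤ q → |F q δ| ≤ (q + 1) * Real.log (C / δ) / (-Real.log δ) := by
    intro δ hδ hδ1
    have hlog : 0 < -Real.log δ := by have := Real.log_neg hδ hδ1; linarith
    have hfin : ∫⁻ x, (ν (Metric.ball x δ))⁻¹ ∂ν ≠ ⊤ :=
      ((hcov δ hδ hδ1).trans_lt ENNReal.ofReal_lt_top).ne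
    have hme : Measurable fun x => (ν (Metric.ball x δ))⁻¹ := (aux_meas ν δ).inv
    have hae : ∀ᵐ x ∂ν, 0 < (ν (Metric.ball x δ)).toReal := by
      filter_upwards [ae_lt_top hme hfin] with x hx
      exact ENNReal.toReal_pos (ENNReal.inv_ne_top.1 hx.ne) (measure_ne_top _ _)
    have hint : Integrable (fun x => ((ν (Metric.ball x δ)).toReal)⁻¹) ν := by
      have := integrable_toReal_of_lintegral_ne_top hme.aemeasurable hfin
      simpa [ENNReal.toReal_inv] using this
    have hNle : ∫ x, ((ν (Metric.ball x δ)).toReal)⁻¹ ∂ν ≤ C / δ := by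
      have h := integral_toReal hme.aemeasurable (ae_lt_top hme hfin)
      simp only [ENNReal.toReal_inv] at h
      rw [h]
      exact ENNReal.toReal_le_of_le_ofReal (by positivity) (hcov δ hδ hδ1)
    obtain ⟨h1, h2, h3⟩ := aux_G ν (fun x => (ν (Metric.ball x δ)).toReal)
      (aux_meas ν δ).ennreal_toReal hae (fun x => measureReal_le_one) (C / δ) hint hNle
    refine ⟨fun q hq q' hq' h => ?_, ?_, fun q hq => ?_⟩
    · exact div_le_div_of_nonneg_right (h1 hq hq' h) hlog.le
    · have := h2.smul (inv_nonneg.2 hlog.le)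
      refine this.congr ?_
      intro q _
      simp only [hF, smul_eq_mul]
      rw [div_eq_inv_mul]
    · simp only [hF]
      rw [abs_div, abs_of_pos hlog]
      exact div_le_div_of_nonneg_right (h3 q hq) hlog.le
  have hev : ∀ᶠ δ in nhdsWithin (0 : ℝ) (Set.Ioi 0), 0 < δ ∧ δ < 1 ∧ δ < 1 / C := by
    have h1 : ∀ᶠ δ in nhdsWithin (0 : ℝ) (Set.Ioi 0), δ ∈ Set.Ioo (0 : ℝ) 1 :=
      Ioo_mem_nhdsGT one_pos
    have h2 : ∀ᶠ δ in nhdsWithin (0 : ℝ) (Set.Ioi 0), δ ∈ Set.Ioo (0 : ℝ) (1 / C) :=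
      Ioo_mem_nhdsGT (by positivity)
    filter_upwards [h1, h2] with δ a b
    exact ⟨a.1, a.2, b.2⟩
  have hbd : ∀ q : ℝ, 0 ≤ q →
      ∀ᶠ δ in nhdsWithin (0 : ℝ) (Set.Ioi 0), |F q δ| ≤ (q + 1) * 2 := by
    intro q hq
    filter_upwards [hev] with δ ⟨h0, h1, h2⟩
    refine ((hG δ h0 h1).2.2 q hq).trans ?_
    have hlog : 0 < -Real.log δ := by have := Real.log_neg h0 h1; linarith
    rw [div_le_iff₀ hlog, mul_assoc]
    apply mul_le_mul_of_nonneg_left _ (by linarith)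
    rw [Real.log_div hC.ne' h0.ne']
    have : Real.log δ ≤ Real.log (1 / C) := Real.log_le_log h0 h2.le
    rw [one_div, Real.log_inv] at this
    linarith
  have htend : ∀ q : ℝ, 0 ≤ q →
      Tendsto (F q) (nhdsWithin (0 : ℝ) (Set.Ioi 0)) (nhds (τ q)) := by
    intro q hq
    refine tendsto_of_liminf_eq_limsup (hτ q hq).1 (hτ q hq).2 ?_ ?_
    · exact isBoundedUnder_of_eventually_le ((hbd q hq).mono fun δ h => (abs_le.1 h).2)
    · exact isBoundedUnder_of_eventually_ge ((hbd q hq).mono fun δ h => (abs_le.1 h).1)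
  have hanti : AntitoneOn τ (Set.Ici 0) := by
    intro q hq q' hq' h
    refine le_of_tendsto_of_tendsto (htend q' hq') (htend q hq) ?_
    filter_upwards [hev] with δ ⟨h0, h1, _⟩
    exact (hG δ h0 h1).1 hq hq' h
  have hconv : ConvexOn ℝ (Set.Ici 0) τ := by
    refine ⟨convex_Ici 0, ?_⟩
    intro x hx y hy a b ha hb hab
    have hz := convex_Ici (0 : ℝ) hx hy ha hb hab
    refine le_of_tendsto_of_tendsto (htend _ hz)
      (((htend x hx).const_smul a).add ((htend y hy).const_smul b)) ?_
    filter_upwards [hev] with δ ⟨h0, h1, _⟩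
    exact (hG δ h0 h1).2.1.2 hx hy ha hb hab
  refine ⟨hanti, ?_⟩
  have := hconv.continuousOn_interior
  rwa [interior_Ici] at this

/-! ### Part B: the pressure function -/

lemma dims_bounds {ι : Type} (B : IFSData ι) (a b : ℝ) (ha : 0 < a)
    (h : ∀ i, a ≤ B.c i ∧ B.c i ≤ b ∧ a ≤ B.d i ∧ B.d i ≤ b) (l : List ι) :
    a ^ l.length ≤ (B.dims l).1 ∧ (B.dims l).1 ≤ b ^ l.length ∧
    a ^ l.length ≤ (B.dims l).2 ∧ (B.dims l).2 ≤ b ^ l.length := by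
  induction l with
  | nil => simp [IFSData.dims]
  | cons i l ih =>
    obtain ⟨h1, h2, h3, h4⟩ := ih
    obtain ⟨g1, g2, g3, g4⟩ := h i
    have hb : 0 ≤ b := by linarith
    have e : B.dims (i :: l) = (B.c i * (if B.swap i then (B.dims l).2 else (B.dims l).1),
        B.d i * (if B.swap i then (B.dims l).1 else (B.dims l).2)) := rfl
    have hp : 0 < a ^ l.length := pow_pos ha _
    rw [e, List.length_cons, pow_succ', pow_succ']
    cases B.swap i <;> simp only [if_true, if_false, Bool.false_eq_true] <;>
      refine ⟨?_, ?_, ?_, ?_⟩ <;> apply mul_le_mul <;> linarith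

lemma wordProb_bounds {ι : Type} (p : ι → ℝ) (a b : ℝ) (ha : 0 < a)
    (h : ∀ i, a ≤ p i ∧ p i ≤ b) (l : List ι) :
    a ^ l.length ≤ wordProb p l ∧ wordProb p l ≤ b ^ l.length := by
  induction l with
  | nil => simp [wordProb]
  | cons i l ih =>
    obtain ⟨h1, h2⟩ := ih
    obtain ⟨g1, g2⟩ := h i
    have e : wordProb p (i :: l) = p i * wordProb p l := by simp [wordProb]
    have hp : 0 < a ^ l.length := pow_pos ha _
    rw [e, List.length_cons, pow_succ', pow_succ']
    refine ⟨?_, ?_⟩ <;> apply mul_le_mul <;> linarith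

/-- The logarithm of `ψ`. -/
def logPsi {ι : Type} (B : IFSData ι) (p : ι → ℝ) (τ1 τ2 : ℝ → ℝ) (s q : ℝ) (l : List ι) : ℝ :=
  q * Real.log (wordProb p l) +
    tauW B τ1 τ2 l q * (Real.log (B.alpha1 l) - Real.log (B.alpha2 l)) +
    s * Real.log (B.alpha2 l)

lemma psi_eq_exp {ι : Type} (B : IFSData ι) (p : ι → ℝ) (τ1 τ2 : ℝ → ℝ) (s q : ℝ) (l : List ι)
    (h1 : 0 < wordProb p l) (h2 : 0 < B.alpha1 l) (h3 : 0 < B.alpha2 l) :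
    psiSV B p τ1 τ2 s q l = Real.exp (logPsi B p τ1 τ2 s q l) := by
  rw [psiSV, logPsi, Real.rpow_def_of_pos h1, Real.rpow_def_of_pos h2, Real.rpow_def_of_pos h3,
    ← Real.exp_add, ← Real.exp_add]
  congr 1
  ring

lemma exp_nat_rpow_inv (k : ℕ) (hk : k ≠ 0) (ε : ℝ) :
    Real.exp (k * ε) ^ ((k : ℝ)⁻¹) = Real.exp ε := by
  rw [← Real.exp_mul]
  congr 1
  have : (k : ℝ) ≠ 0 := Nat.cast_ne_zero.2 hk
  field_simp

lemma P_le_of {ι : Type} [Fintype ι] (B : IFSData ι) (p : ι → ℝ) (τ1 τ2 : ℝ → ℝ)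
    (hpos : ∀ l : List ι, 0 < wordProb p l ∧ 0 < B.alpha1 l ∧ 0 < B.alpha2 l)
    (P : ℝ → ℝ → ℝ)
    (hP : ∀ s q : ℝ, 0 ≤ q →
      Tendsto (fun k : ℕ => PsiSV B p τ1 τ2 k s q ^ ((k : ℝ)⁻¹)) atTop (nhds (P s q)))
    (s q s' q' ε : ℝ) (hq : 0 ≤ q) (hq' : 0 ≤ q')
    (h : ∀ l : List ι, logPsi B p τ1 τ2 s' q' l ≤ l.length * ε + logPsi B p τ1 τ2 s q l) :
    P s' q' ≤ Real.exp ε * P s q := by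
  have hnn : ∀ k s q, 0 ≤ PsiSV B p τ1 τ2 k s q := by
    intro k s q
    refine Finset.sum_nonneg fun f _ => ?_
    rw [psi_eq_exp _ _ _ _ _ _ _ (hpos _).1 (hpos _).2.1 (hpos _).2.2]
    exact (Real.exp_pos _).le
  refine le_of_tendsto_of_tendsto (hP s' q' hq') ((hP s q hq).const_mul (Real.exp ε)) ?_
  filter_upwards [eventually_ne_atTop 0] with k hk
  rw [← exp_nat_rpow_inv k hk ε, ← Real.mul_rpow (Real.exp_pos _).le (hnn _ _ _)]
  apply Real.rpow_le_rpow (hnn _ _ _) _ (by positivity)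
  rw [PsiSV, PsiSV, Finset.mul_sum]
  refine Finset.sum_le_sum fun f _ => ?_
  rw [psi_eq_exp _ _ _ _ _ _ _ (hpos _).1 (hpos _).2.1 (hpos _).2.2,
    psi_eq_exp _ _ _ _ _ _ _ (hpos _).1 (hpos _).2.1 (hpos _).2.2, ← Real.exp_add]
  apply Real.exp_le_exp.2
  simpa using h (List.ofFn f)

lemma P_pos_of {ι : Type} [Fintype ι] [Nonempty ι] (B : IFSData ι) (p : ι → ℝ) (τ1 τ2 : ℝ → ℝ)
    (hpos : ∀ l : List ι, 0 < wordProb p l ∧ 0 < B.alpha1 l ∧ 0 < B.alpha2 l)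
    (P : ℝ → ℝ → ℝ)
    (hP : ∀ s q : ℝ, 0 ≤ q →
      Tendsto (fun k : ℕ => PsiSV B p τ1 τ2 k s q ^ ((k : ℝ)⁻¹)) atTop (nhds (P s q)))
    (s q ε : ℝ) (hq : 0 ≤ q)
    (h : ∀ l : List ι, l.length * ε ≤ logPsi B p τ1 τ2 s q l) :
    0 < P s q := by
  refine lt_of_lt_of_le (Real.exp_pos ε) (ge_of_tendsto (hP s q hq) ?_)
  filter_upwards [eventually_ne_atTop 0] with k hk
  rw [← exp_nat_rpow_inv k hk ε]
  apply Real.rpow_le_rpow (Real.exp_pos _).le _ (by positivity)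
  obtain ⟨i⟩ := ‹Nonempty ι›
  have h1 : psiSV B p τ1 τ2 s q (List.ofFn fun _ : Fin k => i) ≤ PsiSV B p τ1 τ2 k s q := by
    rw [PsiSV]
    refine Finset.single_le_sum (f := fun f : Fin k → ι => psiSV B p τ1 τ2 s q (List.ofFn f))
      (fun f _ => ?_) (Finset.mem_univ (fun _ : Fin k => i))
    rw [psi_eq_exp _ _ _ _ _ _ _ (hpos _).1 (hpos _).2.1 (hpos _).2.2]
    exact (Real.exp_pos _).le
  refine le_trans ?_ h1
  rw [psi_eq_exp _ _ _ _ _ _ _ (hpos _).1 (hpos _).2.1 (hpos _).2.2]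
  apply Real.exp_le_exp.2
  simpa using h (List.ofFn fun _ : Fin k => i)

theorem properties_of_P
    {ι : Type} [Fintype ι] [Nonempty ι] (hcard : 2 ≤ Fintype.card ι)
    (B : IFSData ι)
    (hc : ∀ i, B.c i ∈ Set.Ioo (0 : ℝ) 1) (hd : ∀ i, B.d i ∈ Set.Ioo (0 : ℝ) 1)
    (p : ι → ℝ) (hp : ∀ i, p i ∈ Set.Ioo (0 : ℝ) 1) (hpsum : ∑ i : ι, p i = 1)
    (μ : Measure (ℝ × ℝ)) [IsProbabilityMeasure μ]
    (hcpt : ∃ K : Set (ℝ × ℝ), IsCompact K ∧ μ Kᶜ = 0)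
    (hself : μ = ∑ i : ι, ENNReal.ofReal (p i) • Measure.map (B.S i) μ)
    (τ1 τ2 : ℝ → ℝ)
    (hτ1 : ∀ q : ℝ, 0 ≤ q → IsLqSpec (Measure.map Prod.fst μ) q (τ1 q))
    (hτ2 : ∀ q : ℝ, 0 ≤ q → IsLqSpec (Measure.map Prod.snd μ) q (τ2 q))
    (P : ℝ → ℝ → ℝ)
    (hP : ∀ s q : ℝ, 0 ≤ q →
      Tendsto (fun k : ℕ => PsiSV B p τ1 τ2 k s q ^ ((k : ℝ)⁻¹)) atTop (nhds (P s q)))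
     :
    (∀ s t : ℝ,
        min (alphaMin B ^ s) (alphaMax B ^ s) * P t 0 ≤ P (s + t) 0 ∧
        P (s + t) 0 ≤ max (alphaMin B ^ s) (alphaMax B ^ s) * P t 0) ∧
    (∀ s q : ℝ, 0 ≤ q → P s q ≤ pMax p ^ q * P s 0) ∧
    ContinuousOn (fun x : ℝ × ℝ => P x.1 x.2) (Set.univ ×ˢ Set.Ioi 0) ∧
    Continuous (fun s : ℝ => P s 0) ∧
    (∀ q : ℝ, 0 ≤ q → StrictAnti fun s : ℝ => P s q) ∧
    (∀ s : ℝ, StrictAntiOn (fun q : ℝ => P s q) (Set.Ici 0)) ∧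
    (∀ q : ℝ, 0 ≤ q → ∃! s : ℝ, P s q = 1) := by
  -- numerical constants
  have hamin0 : 0 < alphaMin B := by
    rw [alphaMin, Finset.lt_inf'_iff]
    exact fun i _ => lt_min (hc i).1 (hd i).1
  have hamax1 : alphaMax B < 1 := by
    rw [alphaMax, Finset.sup'_lt_iff]
    exact fun i _ => max_lt (hc i).2 (hd i).2
  have habd : ∀ i, alphaMin B ≤ B.c i ∧ B.c i ≤ alphaMax B ∧ alphaMin B ≤ B.d i ∧
      B.d i ≤ alphaMax B := by
    intro i
    have h1 : alphaMin B ≤ min (B.c i) (B.d i) :=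
      Finset.inf'_le (fun i => min (B.c i) (B.d i)) (Finset.mem_univ i)
    have h2 : max (B.c i) (B.d i) ≤ alphaMax B :=
      Finset.le_sup' (fun i => max (B.c i) (B.d i)) (Finset.mem_univ i)
    exact ⟨h1.trans (min_le_left _ _), (le_max_left _ _).trans h2,
      h1.trans (min_le_right _ _), (le_max_right _ _).trans h2⟩
  obtain ⟨pmin, hpmin0, hpminle⟩ : ∃ a : ℝ, 0 < a ∧ ∀ i, a ≤ p i := by
    refine ⟨Finset.univ.inf' Finset.univ_nonempty p, ?_, fun i =>
      Finset.inf'_le p (Finset.mem_univ i)⟩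
    rw [Finset.lt_inf'_iff]
    exact fun i _ => (hp i).1
  have hpmaxle : ∀ i, p i ≤ pMax p := fun i => Finset.le_sup' p (Finset.mem_univ i)
  have hpmax1 : pMax p < 1 := by
    rw [pMax, Finset.sup'_lt_iff]
    exact fun i _ => (hp i).2
  obtain ⟨i0⟩ := id ‹Nonempty ι›
  have hamax0 : 0 < alphaMax B := (hc i0).1.trans_le (habd i0).2.1
  have hpmax0 : 0 < pMax p := (hp i0).1.trans_le (hpmaxle i0)
  -- bounds on words
  have hd' := dims_bounds B _ _ hamin0 habd
  have hw := wordProb_bounds p _ _ hpmin0 (fun i => ⟨hpminle i, hpmaxle i⟩)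
  have hpos : ∀ l : List ι, 0 < wordProb p l ∧ 0 < B.alpha1 l ∧ 0 < B.alpha2 l := by
    intro l
    have h1 := pow_pos hamin0 l.length
    obtain ⟨g1, g2, g3, g4⟩ := hd' l
    exact ⟨(pow_pos hpmin0 _).trans_le (hw l).1, lt_max_of_lt_left (h1.trans_le g1),
      lt_min (h1.trans_le g1) (h1.trans_le g3)⟩
  set la := Real.log (alphaMin B) with hla
  set lb := Real.log (alphaMax B) with hlb
  set ra := Real.log pmin with hra
  set rb := Real.log (pMax p) with hrb
  have hlb0 : lb < 0 := Real.log_neg hamax0 hamax1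
  have hrb0 : rb < 0 := Real.log_neg hpmax0 hpmax1
  have hlab : la ≤ lb := Real.log_le_log hamin0 ((habd i0).1.trans (habd i0).2.1)
  have hrab : ra ≤ rb := Real.log_le_log hpmin0 ((hpminle i0).trans (hpmaxle i0))
  have hlogs : ∀ l : List ι,
      (l.length * ra ≤ Real.log (wordProb p l) ∧ Real.log (wordProb p l) ≤ l.length * rb) ∧
      (l.length * la ≤ Real.log (B.alpha2 l) ∧ Real.log (B.alpha2 l) ≤ l.length * lb) ∧
      (Real.log (B.alpha2 l) ≤ Real.log (B.alpha1 l) ∧ Real.log (B.alpha1 l) ≤ l.length * lb) := by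
    intro l
    obtain ⟨g1, g2, g3, g4⟩ := hd' l
    obtain ⟨k1, k2, k3⟩ := hpos l
    simp only [hla, hlb, hra, hrb, ← Real.log_pow]
    exact ⟨⟨Real.log_le_log (pow_pos hpmin0 _) (hw l).1, Real.log_le_log k1 (hw l).2⟩,
      ⟨Real.log_le_log (pow_pos hamin0 _) (le_min g1 g3),
        Real.log_le_log k3 ((min_le_left _ _).trans g2)⟩,
      Real.log_le_log k3 min_le_max, Real.log_le_log k2 (max_le g2 g4)⟩
  -- spectra
  obtain ⟨K, hK, hKμ⟩ := hcpt
  have hA1 : AntitoneOn τ1 (Set.Ici 0) ∧ ContinuousOn τ1 (Set.Ioi 0) := by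
    have := Measure.isProbabilityMeasure_map (μ := μ) (measurable_fst.aemeasurable)
    have hKc : IsCompact (Prod.fst '' K) := hK.image continuous_fst
    refine aux_spec (Measure.map Prod.fst μ) (Prod.fst '' K) hKc ?_ τ1 hτ1
    rw [Measure.map_apply measurable_fst hKc.measurableSet.compl]
    exact measure_mono_null (fun x hx hxK => hx ⟨x, hxK, rfl⟩) hKμ
  have hA2 : AntitoneOn τ2 (Set.Ici 0) ∧ ContinuousOn τ2 (Set.Ioi 0) := by
    have := Measure.isProbabilityMeasure_map (μ := μ) (measurable_snd.aemeasurable)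
    have hKc : IsCompact (Prod.snd '' K) := hK.image continuous_snd
    refine aux_spec (Measure.map Prod.snd μ) (Prod.snd '' K) hKc ?_ τ2 hτ2
    rw [Measure.map_apply measurable_snd hKc.measurableSet.compl]
    exact measure_mono_null (fun x hx hxK => hx ⟨x, hxK, rfl⟩) hKμ
  have htau_anti : ∀ (l : List ι) (q q' : ℝ), 0 ≤ q → q ≤ q' →
      tauW B τ1 τ2 l q' ≤ tauW B τ1 τ2 l q := by
    intro l q q' hq hqq
    unfold tauW
    split_ifs
    · exact hA1.1 hq (hq.trans hqq) hqq
    · exact hA2.1 hq (hq.trans hqq) hqq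
  have htau_diff : ∀ (l : List ι) (q q' : ℝ),
      |tauW B τ1 τ2 l q' - tauW B τ1 τ2 l q| ≤ |τ1 q' - τ1 q| + |τ2 q' - τ2 q| := by
    intro l q q'
    unfold tauW
    split_ifs
    · exact le_add_of_nonneg_right (abs_nonneg _)
    · exact le_add_of_nonneg_left (abs_nonneg _)
  have htau_abs : ∀ (l : List ι) (q : ℝ), |tauW B τ1 τ2 l q| ≤ |τ1 q| + |τ2 q| := by
    intro l q
    unfold tauW
    split_ifs
    · exact le_add_of_nonneg_right (abs_nonneg _)
    · exact le_add_of_nonneg_left (abs_nonneg _)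
  have hcomp := P_le_of B p τ1 τ2 hpos P hP
  -- a common bound for all logarithms
  set A : ℝ := -la - ra with hAdef
  have hA0 : 0 < A := by linarith
  have hAw : ∀ l : List ι, |Real.log (wordProb p l)| ≤ l.length * A ∧
      |Real.log (B.alpha2 l)| ≤ l.length * A ∧
      |Real.log (B.alpha1 l) - Real.log (B.alpha2 l)| ≤ l.length * A := by
    intro l
    obtain ⟨⟨h1, h2⟩, ⟨h3, h4⟩, h5, h6⟩ := hlogs l
    have hn : (0 : ℝ) ≤ l.length := Nat.cast_nonneg _
    have e1 : (l.length : ℝ) * rb ≤ 0 := mul_nonpos_of_nonneg_of_nonpos hn hrb0.le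
    have e2 : (l.length : ℝ) * lb ≤ 0 := mul_nonpos_of_nonneg_of_nonpos hn hlb0.le
    have e3 : (l.length : ℝ) * A = -(l.length * la) - l.length * ra := by rw [hAdef]; ring
    rw [e3]
    refine ⟨abs_le.2 ⟨by linarith, by linarith⟩, abs_le.2 ⟨by linarith, by linarith⟩,
      abs_le.2 ⟨by linarith, by linarith⟩⟩
  have hmulb : ∀ x y M D : ℝ, |x| ≤ D → |y| ≤ M → x * y ≤ D * M ∧ -(D * M) ≤ x * y := by
    intro x y M D hx hy
    have : |x * y| ≤ D * M := by
      rw [abs_mul]; exact mul_le_mul hx hy (abs_nonneg _) ((abs_nonneg _).trans hx)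
    exact ⟨(abs_le.1 this).2, (abs_le.1 this).1⟩
  have hPpos : ∀ s q : ℝ, 0 ≤ q → 0 < P s q := by
    intro s q hq
    refine P_pos_of B p τ1 τ2 hpos P hP s q (-(A * (|q| + (|τ1 q| + |τ2 q|) + |s|))) hq ?_
    intro l
    obtain ⟨h1, h2, h3⟩ := hAw l
    have g1 := (hmulb q _ _ _ le_rfl h1).2
    have g2 := (hmulb s _ _ _ le_rfl h2).2
    have g3 := (hmulb (tauW B τ1 τ2 l q) _ _ _ (htau_abs l q) h3).2
    unfold logPsi
    nlinarith
  -- joint modulus of continuity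
  have hmod : ∀ s q s' q' : ℝ, 0 ≤ q → 0 ≤ q' → P s' q' ≤
      Real.exp (A * (|q' - q| + (|τ1 q' - τ1 q| + |τ2 q' - τ2 q|) + |s' - s|)) * P s q := by
    intro s q s' q' hq hq'
    refine hcomp s q s' q' _ hq hq' ?_
    intro l
    obtain ⟨h1, h2, h3⟩ := hAw l
    have g1 := (hmulb (q' - q) _ _ _ le_rfl h1).1
    have g2 := (hmulb (s' - s) _ _ _ le_rfl h2).1
    have g3 := (hmulb (tauW B τ1 τ2 l q' - tauW B τ1 τ2 l q) _ _ _ (htau_diff l q q') h3).1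
    unfold logPsi
    nlinarith
  have hmod2 : ∀ s q s' q' : ℝ, 0 ≤ q → 0 ≤ q' →
      Real.exp (-(A * (|q' - q| + (|τ1 q' - τ1 q| + |τ2 q' - τ2 q|) + |s' - s|))) * P s q
        ≤ P s' q' := by
    intro s q s' q' hq hq'
    have := hmod s' q' s q hq' hq
    rw [abs_sub_comm q q', abs_sub_comm (τ1 q), abs_sub_comm (τ2 q), abs_sub_comm s s'] at this
    rw [Real.exp_neg, inv_mul_le_iff₀ (Real.exp_pos _)]
    exact this
  -- comparison in `s`
  have hs_lt : ∀ q s s' : ℝ, 0 ≤ q → s ≤ s' →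
      P s' q ≤ Real.exp ((s' - s) * lb) * P s q ∧ Real.exp ((s' - s) * la) * P s q ≤ P s' q := by
    intro q s s' hq hss
    constructor
    · refine hcomp s q s' q _ hq hq fun l => ?_
      have := mul_le_mul_of_nonneg_left (hlogs l).2.1.2 (sub_nonneg.2 hss)
      unfold logPsi
      linarith
    · have : P s q ≤ Real.exp (-((s' - s) * la)) * P s' q := by
        refine hcomp s' q s q _ hq hq fun l => ?_
        have := mul_le_mul_of_nonneg_left (hlogs l).2.1.1 (sub_nonneg.2 hss)
        unfold logPsi
        linarith
      rwa [Real.exp_neg, le_inv_mul_iff₀ (Real.exp_pos _)] at this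
  -- comparison in `q`
  have hq_lt : ∀ s q q' : ℝ, 0 ≤ q → q ≤ q' →
      P s q' ≤ Real.exp ((q' - q) * rb) * P s q := by
    intro s q q' hq hqq
    refine hcomp s q s q' _ hq (hq.trans hqq) fun l => ?_
    have h1 := mul_le_mul_of_nonneg_left (hlogs l).1.2 (sub_nonneg.2 hqq)
    have h2 := mul_le_mul_of_nonneg_right (htau_anti l q q' hq hqq)
      (sub_nonneg.2 (hlogs l).2.2.1)
    unfold logPsi
    linarith
  have hcont_s : ∀ q : ℝ, 0 ≤ q → Continuous fun s : ℝ => P s q := by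
    intro q hq
    rw [continuous_iff_continuousAt]
    intro s
    have hω : Tendsto (fun s' : ℝ => A * (|q - q| + (|τ1 q - τ1 q| + |τ2 q - τ2 q|) + |s' - s|))
        (nhds s) (nhds 0) := by
      have : Continuous (fun s' : ℝ =>
          A * (|q - q| + (|τ1 q - τ1 q| + |τ2 q - τ2 q|) + |s' - s|)) := by fun_prop
      have h := this.tendsto s
      simpa using h
    have hu := ((Real.continuous_exp.tendsto _).comp hω).mul_const (P s q)
    have hl := ((Real.continuous_exp.tendsto _).comp hω.neg).mul_const (P s q)
    simp only [neg_zero, Real.exp_zero, one_mul] at hu hl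
    exact tendsto_of_tendsto_of_tendsto_of_le_of_le hl hu
      (fun s' => hmod2 s q s' q hq hq) (fun s' => hmod s q s' q hq hq)
  have hanti_s : ∀ q : ℝ, 0 ≤ q → StrictAnti fun s : ℝ => P s q := by
    intro q hq s s' hss
    refine lt_of_le_of_lt (hs_lt q s s' hq hss.le).1 ?_
    have : Real.exp ((s' - s) * lb) < 1 := by
      rw [Real.exp_lt_one_iff]; exact mul_neg_of_pos_of_neg (sub_pos.2 hss) hlb0
    have h2 := mul_lt_mul_of_pos_right this (hPpos s q hq)
    linarith
  refine ⟨?_, ?_, ?_, hcont_s 0 le_rfl, hanti_s, ?_, ?_⟩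
  · intro s t
    have ea : alphaMin B ^ s = Real.exp (s * la) := by
      rw [Real.rpow_def_of_pos hamin0, mul_comm]
    have eb : alphaMax B ^ s = Real.exp (s * lb) := by
      rw [Real.rpow_def_of_pos hamax0, mul_comm]
    rw [ea, eb]
    have hPt := (hPpos t 0 le_rfl).le
    rcases le_total 0 s with hs | hs
    · obtain ⟨h1, h2⟩ := hs_lt 0 t (s + t) le_rfl (by linarith)
      rw [add_sub_cancel_right] at h1 h2
      exact ⟨(mul_le_mul_of_nonneg_right (min_le_left _ _) hPt).trans h2,
        h1.trans (mul_le_mul_of_nonneg_right (le_max_right _ _) hPt)⟩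
    · obtain ⟨h1, h2⟩ := hs_lt 0 (s + t) t le_rfl (by linarith)
      have e : t - (s + t) = -s := by ring
      rw [e, neg_mul, Real.exp_neg] at h1 h2
      rw [le_inv_mul_iff₀ (Real.exp_pos _)] at h1
      rw [inv_mul_le_iff₀ (Real.exp_pos _)] at h2
      exact ⟨(mul_le_mul_of_nonneg_right (min_le_right _ _) hPt).trans h1,
        h2.trans (mul_le_mul_of_nonneg_right (le_max_left _ _) hPt)⟩
  · intro s q hq
    have := hq_lt s 0 q le_rfl hq
    rwa [sub_zero, mul_comm q, hrb, ← Real.rpow_def_of_pos hpmax0] at this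
  · rintro ⟨s, q⟩ ⟨-, hq⟩
    have hq0 : (0 : ℝ) < q := hq
    have hopen : (Set.univ ×ˢ Set.Ioi 0 : Set (ℝ × ℝ)) ∈ nhds (s, q) :=
      (isOpen_univ.prod isOpen_Ioi).mem_nhds ⟨Set.mem_univ _, hq⟩
    apply ContinuousAt.continuousWithinAt
    have c1 : ContinuousAt (fun x : ℝ × ℝ => τ1 x.2) (s, q) :=
      ContinuousAt.comp (f := Prod.snd) (g := τ1) (hA1.2.continuousAt (Ioi_mem_nhds hq0))
        continuousAt_snd
    have c2 : ContinuousAt (fun x : ℝ × ℝ => τ2 x.2) (s, q) :=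
      ContinuousAt.comp (f := Prod.snd) (g := τ2) (hA2.2.continuousAt (Ioi_mem_nhds hq0))
        continuousAt_snd
    have hω : Tendsto (fun x : ℝ × ℝ =>
        A * (|x.2 - q| + (|τ1 x.2 - τ1 q| + |τ2 x.2 - τ2 q|) + |x.1 - s|))
        (nhds (s, q)) (nhds 0) := by
      have : ContinuousAt (fun x : ℝ × ℝ =>
          A * (|x.2 - q| + (|τ1 x.2 - τ1 q| + |τ2 x.2 - τ2 q|) + |x.1 - s|)) (s, q) :=
        continuousAt_const.mul ((((continuousAt_snd.sub continuousAt_const).abs).add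
          (((c1.sub continuousAt_const).abs).add ((c2.sub continuousAt_const).abs))).add
          ((continuousAt_fst.sub continuousAt_const).abs))
      have h := this.tendsto
      simpa using h
    have hu := ((Real.continuous_exp.tendsto _).comp hω).mul_const (P s q)
    have hl := ((Real.continuous_exp.tendsto _).comp hω.neg).mul_const (P s q)
    simp only [neg_zero, Real.exp_zero, one_mul] at hu hl
    refine tendsto_of_tendsto_of_tendsto_of_le_of_le' hl hu ?_ ?_
    · filter_upwards [hopen] with x hx
      exact hmod2 s q x.1 x.2 hq0.le (le_of_lt hx.2)
    · filter_upwards [hopen] with x hx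
      exact hmod s q x.1 x.2 hq0.le (le_of_lt hx.2)
  · intro s q hq q' hq' hqq
    refine lt_of_le_of_lt (hq_lt s q q' hq hqq.le) ?_
    have : Real.exp ((q' - q) * rb) < 1 := by
      rw [Real.exp_lt_one_iff]; exact mul_neg_of_pos_of_neg (sub_pos.2 hqq) hrb0
    have h2 := mul_lt_mul_of_pos_right this (hPpos s q hq)
    linarith
  · intro q hq
    have h0 := hPpos 0 q hq
    set L := |Real.log (P 0 q)| / (-lb) with hL
    have hlbn : 0 < -lb := by linarith
    have hL0 : 0 ≤ L := by positivity
    have hLl : L * lb = -|Real.log (P 0 q)| := by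
      have hne : lb ≠ 0 := hlb0.ne
      rw [hL, div_neg, neg_mul, div_mul_cancel₀ _ hne]
    have hlow : P L q ≤ 1 := by
      refine (hs_lt q 0 L hq hL0).1.trans ?_
      rw [sub_zero, hLl]
      nth_rewrite 2 [← Real.exp_log h0]
      rw [← Real.exp_add, Real.exp_le_one_iff]
      linarith [le_abs_self (Real.log (P 0 q))]
    have hhigh : 1 ≤ P (-L) q := by
      have := (hs_lt q (-L) 0 hq (by linarith)).1
      rw [zero_sub, neg_neg, hLl] at this
      nth_rewrite 1 [← Real.exp_log h0] at this
      rw [Real.exp_neg, le_inv_mul_iff₀ (Real.exp_pos _), ← Real.exp_add] at this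
      refine le_trans ?_ this
      rw [Real.one_le_exp_iff]
      linarith [neg_abs_le (Real.log (P 0 q))]
    obtain ⟨s, hs⟩ := mem_range_of_exists_le_of_exists_ge (hcont_s q hq) ⟨L, hlow⟩ ⟨-L, hhigh⟩
    exact ⟨s, hs, fun s' hs' => (hanti_s q hq).injective (hs'.trans hs.symm)⟩
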